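/- Let a₁,a₂,a₃ be nonzero complex numbers and c = (c₁,c₂) ∈ ℂ² with c ≠ 0. Suppose f₁,f₂ : ℂ² → ℂ are transcendental entire functions of finite order satisfying, for all z ∈ ℂ², a₁²f₁(z)² + (a₂f₂(z+c) + a₃f₂(z))² = 1 and a₁²f₂(z)² + (a₂f₁(z+c) + a₃f₁(z))² = 1. Then there exist constants α₁, α₂, A, k ∈ ℂ and a polynomial φ of one complex variable such that, writing g(z) = α₁z₁ + α₂z₂ + φ(c₂z₁ − c₁z₂) + A and L(c) = α₁c₁ + α₂c₂, one of the following holds: (I) f₁(z) = cos(g(z))/a₁ and f₂(z) = cos(g(z) + k)/a₁ for all z, with a₂² = a₁² + a₃², e^{2ik} = 1 and e^{2iL(c)} = −(a₁ − i a₃ e^{−ik})/(a₁ + i a₃ e^{ik}); (II) f₁(z) = cos(−g(z) + k)/a₁ and f₂(z) = cos(g(z))/a₁ for all z, with (e^{ik})² = −1 and either (a) e^{iL(c)} = 1 and a₁² = (a₂ + a₃)², or (b) e^{iL(c)} = −1 and a₁² = (a₂ − a₃)²; (III) f₁(z) = cos(−g(z) + L(c) + k)/a₁ and f₂(z) = cos(g(z))/a₁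 for all z, with (e^{ik})² = −1 and either (a) e^{iL(c)} = 1 and a₁² = (a₂ + a₃)², or (b) e^{iL(c)} = −1 and a₁² = (a₂ − a₃)². -/

import Mathlib

/-- A function on ℂ² is entire if it is holomorphic everywhere. -/
def Entire2 (f : ℂ × ℂ → ℂ) : Prop := Differentiable ℂ f

/-- A function on ℂ² is transcendental if it is not a polynomial function. -/
def Transcendental2 (f : ℂ × ℂ → ℂ) : Prop :=
  ¬ ∃ p : MvPolynomial (Fin 2) ℂ, ∀ z : ℂ × ℂ, f z = MvPolynomial.eval ![z.1, z.2] p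

/-- A function on ℂ² is of finite order if |f(z)| ≤ exp(‖z‖^ρ) for all large ‖z‖. -/
def FiniteOrder2 (f : ℂ × ℂ → ℂ) : Prop :=
  ∃ ρ > (0 : ℝ), ∃ R > (0 : ℝ), ∀ z : ℂ × ℂ, R ≤ ‖z‖ → ‖f z‖ ≤ Real.exp (‖z‖ ^ ρ)

section EntireSolutions

open Polynomial Topology

section OneVariable

/-- An entire function whose real part has polynomial growth is a polynomial. -/
theorem exists_polynomial_of_re_le {h : ℂ → ℂ} (hd : Differentiable ℂ h) {C : ℝ} (hC : 0 ≤ C)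
    {N : ℕ} (hre : ∀ t, (h t).re ≤ C * (1 + ‖t‖) ^ N) : ∃ P : ℂ[X], ∀ t, h t = P.eval t := by
  set K : ℝ := 2 * ((C + 1) * 3 ^ N) + 3 * ‖h 0‖ with hK
  have hbound : ∀ R : ℝ, 1 ≤ R → ∀ z ∈ Metric.sphere (0 : ℂ) R, ‖h z‖ ≤ K * R ^ N := by
    intro R hR z hz
    have hzR : ‖z‖ = R := by simpa using hz
    have hR0 : 0 < R := by linarith
    have hM : 0 < (C + 1) * (3 * R) ^ N := by positivity
    have hmaps : Set.MapsTo h (Metric.ball 0 (2 * R)) {w | w.re ≤ (C + 1) * (3 * R) ^ N} := by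
      intro x hx
      have hx' : ‖x‖ < 2 * R := by simpa using hx
      rw [Set.mem_ofPred_eq]
      refine (hre x).trans ?_
      gcongr
      · linarith
      · linarith
    have := Complex.borelCaratheodory hM hd.differentiableOn hmaps (by positivity)
      (z := z) (by simp [hzR]; linarith)
    rw [hzR] at this
    refine this.trans ?_
    have e1 : 2 * R - R = R := by ring
    have e2 : 2 * ((C + 1) * (3 * R) ^ N) * R / (2 * R - R) +
        ‖h 0‖ * (2 * R + R) / (2 * R - R) = 2 * ((C + 1) * 3 ^ N) * R ^ N + 3 * ‖h 0‖ := by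
      rw [e1, mul_pow]; field_simp; ring
    rw [e2, hK, add_mul]
    linarith [le_mul_of_one_le_right (a := 3 * ‖h 0‖) (by positivity) (one_le_pow₀ (n := N) hR)]
  have hK0 : 0 ≤ K := by positivity
  have hzero : ∀ n, N < n → iteratedDeriv n h 0 = 0 := by
    intro n hn
    by_contra hne
    have hpos : 0 < ‖iteratedDeriv n h 0‖ := norm_pos_iff.mpr hne
    set x := ‖iteratedDeriv n h 0‖
    set R : ℝ := n.factorial * K / x + 1 with hRdef
    have hR : 1 ≤ R := by
      have : 0 ≤ n.factorial * K / x := by positivity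
      linarith
    have hR0 : 0 < R := by linarith
    have h1 := Complex.norm_iteratedDeriv_le_of_forall_mem_sphere_norm_le n hR0
      hd.diffContOnCl (hbound R hR)
    have h2 : x * R ≤ n.factorial * K := by
      have h3 : x * R ^ n ≤ n.factorial * K * R ^ N := by
        rw [le_div_iff₀ (by positivity)] at h1
        linarith
      have h4 : R * R ^ N ≤ R ^ n := by
        rw [← pow_succ']
        exact pow_le_pow_right₀ hR hn
      have h5 : x * R * R ^ N ≤ n.factorial * K * R ^ N := by
        calc x * R * R ^ N = x * (R * R ^ N) := by ring
          _ ≤ x * R ^ n := by gcongr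
          _ ≤ _ := h3
      exact le_of_mul_le_mul_right h5 (by positivity)
    have h6 : x * R = n.factorial * K + x := by
      rw [hRdef]; field_simp
    linarith
  refine ⟨∑ n ∈ Finset.range (N + 1), Polynomial.C (((n.factorial : ℂ))⁻¹ * iteratedDeriv n h 0) * X ^ n,
    fun t => ?_⟩
  rw [← Complex.taylorSeries_eq_of_entire' 0 t hd, tsum_eq_sum (s := Finset.range (N + 1))]
  · simp [eval_finsetSum]
  · intro n hn
    rw [hzero n (by simpa using hn)]
    simp

/-- The operator on coefficients induced by differentiating `b * exp W`. -/
noncomputable def twistedDerivative (W b : ℂ[X]) : ℂ[X] := derivative b + b * derivative W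

theorem twistedDerivative_ne_zero {W b : ℂ[X]} (hW : derivative W ≠ 0) (hb : b ≠ 0) :
    twistedDerivative W b ≠ 0 := by
  intro h
  have h1 : derivative b = -(b * derivative W) := eq_neg_of_add_eq_zero_left h
  have h2 : (derivative b).degree < b.degree := degree_derivative_lt hb
  rw [h1, degree_neg, degree_mul] at h2
  have h3 : (0 : WithBot ℕ) ≤ (derivative W).degree := zero_le_degree_iff.mpr hW
  have h4 : b.degree ≤ b.degree + (derivative W).degree := le_add_of_nonneg_right h3
  exact absurd h2 (not_lt.mpr h4)

theorem twistedDerivative_iterate_ne_zero {W b : ℂ[X]} (hW : derivative W ≠ 0) (hb : b ≠ 0)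
    (m : ℕ) : (twistedDerivative W)^[m] b ≠ 0 := by
  induction m with
  | zero => simpa
  | succ m ih =>
    rw [Function.iterate_succ_apply']
    exact twistedDerivative_ne_zero hW ih

theorem hasDerivAt_eval_mul_exp (W b : ℂ[X]) (t : ℂ) :
    HasDerivAt (fun t => b.eval t * Complex.exp (W.eval t))
      ((twistedDerivative W b).eval t * Complex.exp (W.eval t)) t := by
  have := (b.hasDerivAt t).mul (W.hasDerivAt t).cexp
  convert! this using 1
  simp [twistedDerivative]
  ring

theorem sum_iterate_twistedDerivative_eq_zero {ι : Type*} (s : Finset ι) (U c : ι → ℂ[X])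
    (V b d : ℂ[X])
    (h : ∀ t, ∑ k ∈ s, (c k).eval t * Complex.exp ((U k).eval t) +
      b.eval t * Complex.exp (V.eval t) + d.eval t = 0) (m : ℕ) :
    ∀ t, ∑ k ∈ s, ((twistedDerivative (U k))^[m] (c k)).eval t * Complex.exp ((U k).eval t) +
      ((twistedDerivative V)^[m] b).eval t * Complex.exp (V.eval t) +
      (derivative^[m] d).eval t = 0 := by
  induction m with
  | zero => simpa using h
  | succ m ih =>
    intro t
    simp only [Function.iterate_succ_apply']
    have h1 := ((HasDerivAt.fun_sum (u := s) fun k _ => hasDerivAt_eval_mul_exp (U k)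
      ((twistedDerivative (U k))^[m] (c k)) t).add
      (hasDerivAt_eval_mul_exp V ((twistedDerivative V)^[m] b) t)).add
      ((derivative^[m] d).hasDerivAt t)
    refine h1.unique ?_
    convert! hasDerivAt_const t (0 : ℂ) using 1
    ext t
    exact ih t

/-- **Borel's theorem** for exponentials of polynomials: if one exponent differs from all others by
nonconstant polynomials, then its coefficient in a vanishing combination is zero. -/
theorem coeff_eq_zero_of_sum_exp_eq_zero {ι : Type*} [DecidableEq ι] (s : Finset ι)
    (U c : ι → ℂ[X]) (V b : ℂ[X]) (hne : ∀ k ∈ s, derivative (V - U k) ≠ 0)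
    (h : ∀ t, ∑ k ∈ s, (c k).eval t * Complex.exp ((U k).eval t) +
      b.eval t * Complex.exp (V.eval t) = 0) : b = 0 := by
  induction s using Finset.induction_on generalizing U c V b with
  | empty =>
    refine Polynomial.funext fun t => ?_
    simpa using h t
  | insert k s hk ih =>
    by_contra hb
    have h1 : ∀ t, ∑ j ∈ s, (c j).eval t * Complex.exp ((U j - U k).eval t) +
        b.eval t * Complex.exp ((V - U k).eval t) + (c k).eval t = 0 := by
      intro t
      have h2 := h t
      rw [Finset.sum_insert hk] at h2
      simp only [eval_sub, Complex.exp_sub, ← mul_div_assoc]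
      rw [← Finset.sum_div]
      field_simp
      linear_combination h2
    have h3 := sum_iterate_twistedDerivative_eq_zero s (fun j => U j - U k) c (V - U k) b (c k) h1
      ((c k).natDegree + 1)
    refine twistedDerivative_iterate_ne_zero (hne k (by simp)) hb ((c k).natDegree + 1)
      (ih (fun j => U j - U k) (fun j => (twistedDerivative (U j - U k))^[(c k).natDegree + 1] (c j))
        (V - U k) _ (fun j hj => ?_) fun t => ?_)
    · simpa using hne j (by simp [hj])
    · have h4 := h3 t
      rw [iterate_derivative_eq_zero (Nat.lt_succ_self _)] at h4
      simpa using h4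

end OneVariable

section SeveralVariables

variable {E : Type*} [NormedAddCommGroup E]

/-- Growth bounded by the exponential of a polynomial in the norm. -/
def ExpGrowth (f : E → ℂ) : Prop :=
  ∃ C : ℝ, 0 ≤ C ∧ ∃ N : ℕ, ∀ z, ‖f z‖ ≤ Real.exp (C * (1 + ‖z‖) ^ N)

namespace ExpGrowth

variable {f g : E → ℂ}

theorem const_mul (a : ℂ) (hf : ExpGrowth f) : ExpGrowth fun z => a * f z := by
  obtain ⟨C, hC, N, h⟩ := hf
  refine ⟨‖a‖ + C, by positivity, N, fun z => ?_⟩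
  have h1 : (1 : ℝ) ≤ (1 + ‖z‖) ^ N := one_le_pow₀ (by linarith [norm_nonneg z])
  have h2 : ‖a‖ ≤ Real.exp (‖a‖ * (1 + ‖z‖) ^ N) := by
    have := Real.add_one_le_exp (‖a‖ * (1 + ‖z‖) ^ N)
    nlinarith [norm_nonneg a]
  rw [norm_mul, add_mul, Real.exp_add]
  gcongr
  exact h z

theorem add (hf : ExpGrowth f) (hg : ExpGrowth g) : ExpGrowth fun z => f z + g z := by
  obtain ⟨C, hC, N, hf⟩ := hf
  obtain ⟨D, hD, M, hg⟩ := hg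
  refine ⟨C + D + 1, by positivity, N + M, fun z => ?_⟩
  have h0 : (1 : ℝ) ≤ 1 + ‖z‖ := by linarith [norm_nonneg z]
  have h1 : (1 : ℝ) ≤ (1 + ‖z‖) ^ (N + M) := one_le_pow₀ h0
  have h2 : Real.exp (C * (1 + ‖z‖) ^ N) ≤ Real.exp ((C + D) * (1 + ‖z‖) ^ (N + M)) := by
    gcongr <;> first | exact h0 | omega | linarith
  have h3 : Real.exp (D * (1 + ‖z‖) ^ M) ≤ Real.exp ((C + D) * (1 + ‖z‖) ^ (N + M)) := by
    gcongr <;> first | exact h0 | omega | linarith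
  have h4 : 2 ≤ Real.exp ((1 + ‖z‖) ^ (N + M)) := by
    have := Real.add_one_le_exp ((1 + ‖z‖) ^ (N + M))
    linarith
  calc ‖f z + g z‖ ≤ ‖f z‖ + ‖g z‖ := norm_add_le _ _
    _ ≤ Real.exp ((C + D) * (1 + ‖z‖) ^ (N + M)) * 2 := by linarith [hf z, hg z]
    _ ≤ Real.exp ((C + D) * (1 + ‖z‖) ^ (N + M)) * Real.exp ((1 + ‖z‖) ^ (N + M)) := by gcongr
    _ = _ := by rw [← Real.exp_add]; ring_nf

theorem comp_add_smul [NormedSpace ℂ E] (hf : ExpGrowth f) (z w : E) :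
    ExpGrowth fun t : ℂ => f (z + t • w) := by
  obtain ⟨C, hC, N, hf⟩ := hf
  refine ⟨C * (1 + ‖z‖ + ‖w‖) ^ N, by positivity, N, fun t => (hf _).trans ?_⟩
  rw [mul_assoc, ← mul_pow]
  have h1 : ‖z + t • w‖ ≤ ‖z‖ + ‖t‖ * ‖w‖ := (norm_add_le _ _).trans (by rw [norm_smul])
  gcongr
  nlinarith [norm_nonneg z, norm_nonneg w, norm_nonneg t,
    mul_nonneg (norm_nonneg z) (norm_nonneg t)]

theorem comp_add_right (hf : ExpGrowth f) (d : E) : ExpGrowth fun z => f (z + d) := by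
  obtain ⟨C, hC, N, hf⟩ := hf
  refine ⟨C * (1 + ‖d‖) ^ N, by positivity, N, fun z => (hf _).trans ?_⟩
  rw [mul_assoc, ← mul_pow]
  have h1 : ‖z + d‖ ≤ ‖z‖ + ‖d‖ := norm_add_le _ _
  gcongr
  nlinarith [norm_nonneg z, norm_nonneg d, mul_nonneg (norm_nonneg z) (norm_nonneg d)]

end ExpGrowth

variable [NormedSpace ℂ E]

/-- A continuous function all of whose restrictions to complex lines are polynomials. -/
def PolynomialOnLines (u : E → ℂ) : Prop :=
  Continuous u ∧ ∀ z w : E, ∃ P : ℂ[X], ∀ t : ℂ, u (z + t • w) = P.eval t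

namespace PolynomialOnLines

variable {u v : E → ℂ}

theorem const_mul (a : ℂ) (hu : PolynomialOnLines u) : PolynomialOnLines fun z => a * u z := by
  refine ⟨continuous_const.mul hu.1, fun z w => ?_⟩
  obtain ⟨P, hP⟩ := hu.2 z w
  exact ⟨C a * P, fun t => by simp [hP]⟩

theorem comp_add_right (d : E) (hu : PolynomialOnLines u) :
    PolynomialOnLines fun z => u (z + d) := by
  refine ⟨hu.1.comp (continuous_id.add continuous_const), fun z w => ?_⟩
  obtain ⟨P, hP⟩ := hu.2 (z + d) w
  exact ⟨P, fun t => by rw [← hP, add_right_comm]⟩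

theorem sub (hu : PolynomialOnLines u) (hv : PolynomialOnLines v) :
    PolynomialOnLines fun z => u z - v z := by
  refine ⟨hu.1.sub hv.1, fun z w => ?_⟩
  obtain ⟨P, hP⟩ := hu.2 z w
  obtain ⟨Q, hQ⟩ := hv.2 z w
  exact ⟨P - Q, fun t => by simp [hP, hQ]⟩

theorem dense_ne (hu : PolynomialOnLines u) (hne : ∃ z, u z ≠ u 0) : Dense {z | u z ≠ u 0} := by
  rw [← compl_compl {z | u z ≠ u 0}, ← interior_eq_empty_iff_dense_compl, Set.eq_empty_iff_forall_notMem]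
  intro z hz
  obtain ⟨w, hw⟩ := hne
  apply hw
  obtain ⟨P, hP⟩ := hu.2 z (w - z)
  have hmem : {y | u y ≠ u 0}ᶜ ∈ 𝓝 (z + (0 : ℂ) • (w - z)) := by
    simpa using mem_interior_iff_mem_nhds.mp hz
  have hcont : Continuous fun t : ℂ => z + t • (w - z) := by fun_prop
  have hev : ∀ᶠ t in 𝓝 (0 : ℂ), P.eval t = u 0 := by
    filter_upwards [hcont.continuousAt.preimage_mem_nhds hmem] with t ht
    rw [← hP]
    simpa using ht
  have hPC : P = C (u 0) := by
    refine Polynomial.eq_of_infinite_eval_eq _ _ ?_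
    refine (infinite_of_mem_nhds (0 : ℂ) hev).mono fun t ht => ?_
    simpa using ht
  have h1 := hP 1
  rw [hPC] at h1
  simpa using h1

theorem exists_forall_ne {ι : Type*} (s : Finset ι) (u : ι → E → ℂ)
    (hu : ∀ k ∈ s, PolynomialOnLines (u k)) (hne : ∀ k ∈ s, ∃ z, u k z ≠ u k 0) :
    ∃ w, ∀ k ∈ s, u k w ≠ u k 0 := by
  classical
  suffices h : Dense {w | ∀ k ∈ s, u k w ≠ u k 0} ∧ IsOpen {w | ∀ k ∈ s, u k w ≠ u k 0} from
    h.1.nonempty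
  induction s using Finset.induction_on with
  | empty => simp
  | insert k s hk ih =>
    simp only [Finset.mem_insert, forall_eq_or_imp] at hu hne ⊢
    obtain ⟨h1, h2⟩ := ih hu.2 hne.2
    have h3 : IsOpen {w | u k w ≠ u k 0} := isOpen_ne_fun hu.1.1 continuous_const
    exact ⟨(hu.1.dense_ne hne.1).inter_of_isOpen_left h1 h3, h3.inter h2⟩

/-- In a vanishing linear combination of exponentials, every exponent with a nonzero coefficient
differs from some other exponent by a constant. -/
theorem exists_sub_eq_const {ι : Type*} [Fintype ι] [DecidableEq ι] (u : ι → E → ℂ)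
    (hu : ∀ k, PolynomialOnLines (u k)) (a : ι → ℂ)
    (h : ∀ z, ∑ k, a k * Complex.exp (u k z) = 0) {j : ι} (ha : a j ≠ 0) :
    ∃ k, k ≠ j ∧ ∃ κ : ℂ, ∀ z, u k z = u j z + κ := by
  by_contra! hcon
  have hne : ∀ k ∈ Finset.univ.erase j, ∃ z, u j z - u k z ≠ u j 0 - u k 0 := by
    intro k hk
    by_contra! hc
    obtain ⟨z, hz⟩ := hcon k (Finset.ne_of_mem_erase hk) (u k 0 - u j 0)
    exact hz (by linear_combination -hc z)
  obtain ⟨w, hw⟩ := exists_forall_ne (Finset.univ.erase j) (fun k z => u j z - u k z)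
    (fun k _ => (hu j).sub (hu k)) hne
  choose P hP using fun k => (hu k).2 0 w
  simp only [zero_add] at hP
  refine ha ?_
  have := coeff_eq_zero_of_sum_exp_eq_zero (Finset.univ.erase j) P (fun k => C (a k)) (P j) (C (a j))
    (fun k hk hd => hw k hk ?_) fun t => ?_
  · simpa using this
  · obtain ⟨x, hx⟩ := natDegree_eq_zero.mp (derivative_eq_zero.mp hd)
    have h1 : ∀ t : ℂ, u j (t • w) - u k (t • w) = x := by
      intro t
      rw [hP, hP, ← eval_sub, ← hx, eval_C]
    have h2 := h1 1
    have h3 := h1 0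
    rw [one_smul] at h2
    rw [zero_smul] at h3
    rw [h2, h3]
  · have := h (t • w)
    rw [← Finset.sum_erase_add _ _ (Finset.mem_univ j)] at this
    simpa [← hP] using this

end PolynomialOnLines

/-- An entire function without zeros has an entire logarithm. -/
theorem exists_differentiable_exp_eq {U : E → ℂ} (hU : Differentiable ℂ U) (h0 : ∀ z, U z ≠ 0) :
    ∃ h : E → ℂ, Differentiable ℂ h ∧ ∀ z, Complex.exp (h z) = U z := by
  let : NormedSpace ℝ E := NormedSpace.restrictScalars ℝ ℂ E
  have : LocallyPathConnectedSpace E := inferInstance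
  have : SimplyConnectedSpace E := inferInstance
  obtain ⟨F, ⟨-, hF⟩, -⟩ := Complex.isCoveringMapOn_exp.existsUnique_continuousMap_lifts
    ⟨U, hU.continuous⟩ (a₀ := 0) (e₀ := Complex.log (U 0)) (Complex.exp_log (h0 0)) h0
  have hexp : ∀ z, Complex.exp (F z) = U z := fun z => congrFun hF z
  refine ⟨F, fun z => ?_, hexp⟩
  have hd : DifferentiableAt ℂ (fun y => F z + Complex.log (U y * (U z)⁻¹)) z := by
    refine DifferentiableAt.const_add _ (DifferentiableAt.clog ?_ ?_)
    · exact (hU z).mul_const _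
    · simp [h0 z]
  refine hd.congr_of_eventuallyEq ?_
  have hcont : ContinuousAt (fun y => (F y - F z).im) z := by fun_prop
  have hmem : Set.Ioo (-Real.pi) Real.pi ∈ 𝓝 ((F z - F z).im) := by
    simpa using Ioo_mem_nhds (neg_lt_zero.mpr Real.pi_pos) Real.pi_pos
  filter_upwards [hcont.preimage_mem_nhds hmem] with y hy
  rw [← hexp y, ← hexp z, ← div_eq_mul_inv, ← Complex.exp_sub, Complex.log_exp hy.1 hy.2.le]
  ring

/-- An entire function without zeros and of finite order is `exp (I * p)` with `p` a polynomial
on every complex line. -/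
theorem exists_polynomialOnLines_exp_eq {U : E → ℂ} (hU : Differentiable ℂ U) (h0 : ∀ z, U z ≠ 0)
    (hg : ExpGrowth U) :
    ∃ p : E → ℂ, PolynomialOnLines p ∧ ∀ z, Complex.exp (Complex.I * p z) = U z := by
  obtain ⟨h, hd, hexp⟩ := exists_differentiable_exp_eq hU h0
  have hh : PolynomialOnLines h := by
    refine ⟨hd.continuous, fun z w => ?_⟩
    obtain ⟨C, hC, N, hb⟩ := hg.comp_add_smul z w
    have hline : Differentiable ℂ fun t : ℂ => z + t • w := by fun_prop
    refine exists_polynomial_of_re_le (hd.comp hline) hC (N := N) fun t => ?_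
    have := hb t
    simp only at this
    rw [← hexp, Complex.norm_exp, Real.exp_le_exp] at this
    exact this
  refine ⟨fun z => -Complex.I * h z, hh.const_mul _, fun z => ?_⟩
  rw [← hexp, ← mul_assoc]
  simp

end SeveralVariables

section Shifts

variable {E : Type*} [NormedAddCommGroup E] [NormedSpace ℂ E] {q : E → ℂ} {c : E}

theorem PolynomialOnLines.add_smul_eq (hq : PolynomialOnLines q) {L : ℂ}
    (h : ∀ z, q (z + c) = q z + L) (z : E) (s : ℂ) : q (z + s • c) = q z + s * L := by
  obtain ⟨P, hP⟩ := hq.2 z c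
  have hnat : ∀ n : ℕ, q (z + (n : ℂ) • c) = q z + n * L := by
    intro n
    induction n with
    | zero => simp
    | succ n ih =>
      have : z + ((n + 1 : ℕ) : ℂ) • c = z + (n : ℂ) • c + c := by
        push_cast; rw [add_smul, one_smul, add_assoc]
      rw [this, h, ih]; push_cast; ring
  have hPC : P = C (q z) + X * C L := by
    refine Polynomial.eq_of_infinite_eval_eq _ _ ?_
    refine (Set.infinite_range_of_injective (Nat.cast_injective (R := ℂ))).mono ?_
    rintro _ ⟨n, rfl⟩
    simp [← hP, hnat]
    ring
  rw [hP, hPC]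
  simp
  ring

theorem PolynomialOnLines.eq_const_of_add_eq_neg (hq : PolynomialOnLines q) {κ : ℂ}
    (h : ∀ z, q (z + c) = -q z + κ) (z : E) : q z = κ / 2 := by
  have h2 : ∀ z, q (z + (2 : ℂ) • c) = q z + 0 := by
    intro z
    rw [two_smul, ← add_assoc, h, h]
    ring
  have h3 := hq.add_smul_eq h2 z (1 / 2)
  rw [smul_smul] at h3
  norm_num at h3
  linear_combination (1 / 2 : ℂ) * h z - (1 / 2 : ℂ) * h3

theorem PolynomialOnLines.exists_normal_form {q : ℂ × ℂ → ℂ} (hq : PolynomialOnLines q)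
    {c : ℂ × ℂ} (hc : c ≠ 0) {L : ℂ} (h : ∀ z, q (z + c) = q z + L) :
    ∃ (α₁ α₂ : ℂ) (φ : ℂ[X]), α₁ * c.1 + α₂ * c.2 = L ∧
      ∀ z, q z = α₁ * z.1 + α₂ * z.2 + φ.eval (c.2 * z.1 - c.1 * z.2) := by
  obtain ⟨d, hd⟩ : ∃ d : ℂ × ℂ, c.2 * d.1 - c.1 * d.2 = 1 := by
    by_cases h2 : c.2 = 0
    · have h1 : c.1 ≠ 0 := fun h1 => hc (Prod.ext h1 h2)
      exact ⟨(0, -c.1⁻¹), by simp [h1]⟩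
    · exact ⟨(c.2⁻¹, 0), by simp [h2]⟩
  obtain ⟨φ, hφ⟩ := hq.2 0 d
  refine ⟨-(L * d.2), L * d.1, φ, by linear_combination L * hd, fun z => ?_⟩
  have hz : z = 0 + (c.2 * z.1 - c.1 * z.2) • d + (d.1 * z.2 - d.2 * z.1) • c := by
    ext
    · simp only [Prod.fst_add, Prod.smul_fst, Prod.fst_zero, smul_eq_mul]
      linear_combination -z.1 * hd
    · simp only [Prod.snd_add, Prod.smul_snd, Prod.snd_zero, smul_eq_mul]
      linear_combination -z.2 * hd
  conv_lhs => rw [hz, hq.add_smul_eq h, hφ]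
  ring

end Shifts

section TrigonometricEquations

variable {E : Type*} [NormedAddCommGroup E] [NormedSpace ℂ E] {p q : E → ℂ}

open Complex (I)

theorem cos_eq_exp (x : ℂ) :
    Complex.cos x = (Complex.exp (I * x) + Complex.exp (-I * x)) / 2 := by
  rw [Complex.cos, mul_comm x I, mul_comm (-x) I, neg_mul, mul_neg]

theorem sin_eq_exp (x : ℂ) :
    Complex.sin x = -I / 2 * (Complex.exp (I * x) - Complex.exp (-I * x)) := by
  rw [Complex.sin, mul_comm x I, mul_comm (-x) I, neg_mul, mul_neg]
  ring

theorem cos_add_eq_exp (x y : ℂ) :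
    Complex.cos (x + y) = (Complex.exp (I * x) * Complex.exp (I * y) +
      Complex.exp (-I * x) * (Complex.exp (I * y))⁻¹) / 2 := by
  rw [cos_eq_exp, mul_add, mul_add, Complex.exp_add, Complex.exp_add, neg_mul I y, Complex.exp_neg]

theorem sin_add_eq_exp (x y : ℂ) :
    Complex.sin (x + y) = -I / 2 * (Complex.exp (I * x) * Complex.exp (I * y) -
      Complex.exp (-I * x) * (Complex.exp (I * y))⁻¹) := by
  rw [sin_eq_exp, mul_add, mul_add, Complex.exp_add, Complex.exp_add, neg_mul I y, Complex.exp_neg]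

theorem PolynomialOnLines.coeff_eq_zero (hq : PolynomialOnLines q)
    (hqc : ¬ ∃ κ, ∀ z, q z = κ) {A B : ℂ}
    (h : ∀ z, A * Complex.exp (I * q z) + B * Complex.exp (-I * q z) = 0) : A = 0 ∧ B = 0 := by
  have hu : ∀ k, PolynomialOnLines ((![fun z => I * q z, fun z => -I * q z] : Fin 2 → E → ℂ) k) := by
    intro k
    fin_cases k
    exacts [hq.const_mul I, hq.const_mul (-I)]
  have hsum : ∀ z, ∑ k, (![A, B] : Fin 2 → ℂ) k *
      Complex.exp ((![fun z => I * q z, fun z => -I * q z] : Fin 2 → E → ℂ) k z) = 0 := by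
    intro z
    simpa [Fin.sum_univ_two] using h z
  constructor
  · by_contra hA
    obtain ⟨k, hk, κ, hκ⟩ := exists_sub_eq_const _ hu _ hsum (j := 0) hA
    fin_cases k
    · exact hk rfl
    · refine hqc ⟨I * κ / 2, fun z => ?_⟩
      have := hκ z
      simp at this
      linear_combination (I / 2) * this + q z * Complex.I_sq
  · by_contra hB
    obtain ⟨k, hk, κ, hκ⟩ := exists_sub_eq_const _ hu _ hsum (j := 1) hB
    fin_cases k
    · refine hqc ⟨-I * κ / 2, fun z => ?_⟩
      have := hκ z
      simp at this
      linear_combination (-I / 2) * this + q z * Complex.I_sq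
    · exact hk rfl

/-- The exponents in `a₂ cos q(z + c) + a₃ cos q(z) = a₁ sin p(z)` agree up to sign and
constants. -/
theorem PolynomialOnLines.exponents_of_cos_add_cos_eq_sin {a₁ a₂ a₃ : ℂ} (ha₁ : a₁ ≠ 0)
    (ha₂ : a₂ ≠ 0) (ha₃ : a₃ ≠ 0) {c : E} (hp : PolynomialOnLines p) (hq : PolynomialOnLines q)
    (hpc : ¬ ∃ κ, ∀ z, p z = κ) (hqc : ¬ ∃ κ, ∀ z, q z = κ)
    (h : ∀ z, a₂ * Complex.cos (q (z + c)) + a₃ * Complex.cos (q z) = a₁ * Complex.sin (p z)) :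
    (∃ L, ∀ z, q (z + c) = q z + L) ∧
      ((∃ k, ∀ z, q z = p z + k) ∨ ∃ k, ∀ z, p z = -q z + k) := by
  have hr := hq.comp_add_right c
  have hI := Complex.I_sq
  set u : Fin 6 → E → ℂ := ![fun z => I * q (z + c), fun z => -I * q (z + c), fun z => I * q z,
    fun z => -I * q z, fun z => I * p z, fun z => -I * p z] with hu_def
  have hu : ∀ k, PolynomialOnLines (u k) := by
    intro k
    fin_cases k
    exacts [hr.const_mul I, hr.const_mul (-I), hq.const_mul I, hq.const_mul (-I), hp.const_mul I,
      hp.const_mul (-I)]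
  have hsum : ∀ z, ∑ k, (![a₂, a₂, a₃, a₃, I * a₁, -I * a₁] : Fin 6 → ℂ) k *
      Complex.exp (u k z) = 0 := by
    intro z
    have := h z
    rw [cos_eq_exp, cos_eq_exp, sin_eq_exp] at this
    simp [Fin.sum_univ_six, hu_def] at this ⊢
    linear_combination 2 * this
  have hrc : ¬ ∃ κ, ∀ z, q (z + c) = κ := fun ⟨κ, hκ⟩ =>
    hqc ⟨κ, fun z => by simpa using hκ (z - c)⟩
  have hrq : ¬ ∃ κ, ∀ z, q (z + c) = -q z + κ := fun ⟨κ, hκ⟩ =>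
    hqc ⟨κ / 2, hq.eq_const_of_add_eq_neg hκ⟩
  have h0 : (∃ κ, ∀ z, q (z + c) = q z + κ) ∨ (∃ κ, ∀ z, q (z + c) = p z + κ) ∨
      (∃ κ, ∀ z, q (z + c) = -p z + κ) := by
    obtain ⟨k, hk, κ, hκ⟩ := exists_sub_eq_const u hu _ hsum (j := 0) ha₂
    fin_cases k <;> simp [hu_def] at hk hκ
    · exact absurd ⟨I * κ / 2, fun z => by
        linear_combination (I / 2) * hκ z + q (z + c) * hI⟩ hrc
    · exact .inl ⟨I * κ, fun z => by linear_combination I * hκ z + (q (z + c) - q z) * hI⟩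
    · exact absurd ⟨I * κ, fun z => by
        linear_combination I * hκ z + (q (z + c) + q z) * hI⟩ hrq
    · exact .inr (.inl ⟨I * κ, fun z => by linear_combination I * hκ z + (q (z + c) - p z) * hI⟩)
    · exact .inr (.inr ⟨I * κ, fun z => by linear_combination I * hκ z + (q (z + c) + p z) * hI⟩)
  have h2 : (∃ κ, ∀ z, q (z + c) = q z + κ) ∨ (∃ κ, ∀ z, q z = p z + κ) ∨
      (∃ κ, ∀ z, q z = -p z + κ) := by
    obtain ⟨k, hk, κ, hκ⟩ := exists_sub_eq_const u hu _ hsum (j := 2) ha₃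
    fin_cases k <;> simp [hu_def] at hk hκ
    · exact .inl ⟨-I * κ, fun z => by linear_combination -I * hκ z + (q (z + c) - q z) * hI⟩
    · exact absurd ⟨I * κ, fun z => by
        linear_combination I * hκ z + (q (z + c) + q z) * hI⟩ hrq
    · exact absurd ⟨I * κ / 2, fun z => by linear_combination (I / 2) * hκ z + q z * hI⟩ hqc
    · exact .inr (.inl ⟨I * κ, fun z => by linear_combination I * hκ z + (q z - p z) * hI⟩)
    · exact .inr (.inr ⟨I * κ, fun z => by linear_combination I * hκ z + (q z + p z) * hI⟩)
  have h4 : (∃ κ, ∀ z, q (z + c) = p z + κ) ∨ (∃ κ, ∀ z, q (z + c) = -p z + κ) ∨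
      (∃ κ, ∀ z, q z = p z + κ) ∨ (∃ κ, ∀ z, q z = -p z + κ) := by
    obtain ⟨k, hk, κ, hκ⟩ := exists_sub_eq_const u hu _ hsum (j := 4)
      (mul_ne_zero Complex.I_ne_zero ha₁)
    fin_cases k <;> simp [hu_def] at hk hκ
    · exact .inl ⟨-I * κ, fun z => by linear_combination -I * hκ z + (q (z + c) - p z) * hI⟩
    · exact .inr (.inl ⟨I * κ, fun z => by linear_combination I * hκ z + (q (z + c) + p z) * hI⟩)
    · exact .inr (.inr (.inl ⟨-I * κ, fun z => by
        linear_combination -I * hκ z + (q z - p z) * hI⟩))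
    · exact .inr (.inr (.inr ⟨I * κ, fun z => by
        linear_combination I * hκ z + (q z + p z) * hI⟩))
    · exact absurd ⟨I * κ / 2, fun z => by linear_combination (I / 2) * hκ z + p z * hI⟩ hpc
  have hL : ∃ κ, ∀ z, q (z + c) = q z + κ := by
    rcases h2 with h | ⟨κ, hκ⟩ | ⟨κ, hκ⟩
    · exact h
    all_goals
      rcases h0 with h | ⟨μ, hμ⟩ | ⟨μ, hμ⟩
      · exact h
      · first
        | exact ⟨μ - κ, fun z => by linear_combination hμ z - hκ z⟩
        | exact absurd ⟨μ + κ, fun z => by linear_combination hμ z + hκ z⟩ hrq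
      · first
        | exact ⟨μ - κ, fun z => by linear_combination hμ z - hκ z⟩
        | exact absurd ⟨μ + κ, fun z => by linear_combination hμ z + hκ z⟩ hrq
  refine ⟨hL, ?_⟩
  obtain ⟨L, hL⟩ := hL
  rcases h4 with ⟨κ, hκ⟩ | ⟨κ, hκ⟩ | h | ⟨κ, hκ⟩
  · exact .inl ⟨κ - L, fun z => by linear_combination hκ z - hL z⟩
  · exact .inr ⟨κ - L, fun z => by linear_combination hκ z - hL z⟩
  · exact .inl h
  · exact .inr ⟨κ, fun z => by linear_combination hκ z⟩

end TrigonometricEquations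

theorem FiniteOrder2.expGrowth {f : ℂ × ℂ → ℂ} (hf : FiniteOrder2 f) (hc : Continuous f) :
    ExpGrowth f := by
  obtain ⟨ρ, hρ, R, hR, h⟩ := hf
  obtain ⟨M, hM⟩ := (isCompact_closedBall (0 : ℂ × ℂ) R).exists_bound_of_continuousOn
    hc.continuousOn
  refine ⟨max M 1, by positivity, ⌈ρ⌉₊, fun z => ?_⟩
  have h0 : (1 : ℝ) ≤ 1 + ‖z‖ := by linarith [norm_nonneg z]
  have h1 : (1 : ℝ) ≤ (1 + ‖z‖) ^ ⌈ρ⌉₊ := one_le_pow₀ h0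
  rcases le_total R ‖z‖ with hz | hz
  · refine (h z hz).trans (Real.exp_le_exp.mpr ?_)
    calc ‖z‖ ^ ρ ≤ (1 + ‖z‖) ^ ρ := Real.rpow_le_rpow (norm_nonneg z) (by linarith) hρ.le
      _ ≤ (1 + ‖z‖) ^ (⌈ρ⌉₊ : ℝ) := Real.rpow_le_rpow_of_exponent_le h0 (Nat.le_ceil ρ)
      _ = (1 + ‖z‖) ^ ⌈ρ⌉₊ := Real.rpow_natCast _ _
      _ ≤ max M 1 * (1 + ‖z‖) ^ ⌈ρ⌉₊ := le_mul_of_one_le_left (by positivity) (le_max_right _ _)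
  · have h2 := hM z (by simpa using hz)
    have h3 := Real.add_one_le_exp (max M 1 * (1 + ‖z‖) ^ ⌈ρ⌉₊)
    have h4 : max M 1 ≤ max M 1 * (1 + ‖z‖) ^ ⌈ρ⌉₊ := le_mul_of_one_le_right (by positivity) h1
    linarith [le_max_left M 1]

/-- The equation `F ^ 2 + G ^ 2 = 1` for entire functions of finite order is solved by
`F = cos p`, `G = sin p`. -/
theorem exists_eq_cos_and_eq_sin {E : Type*} [NormedAddCommGroup E] [NormedSpace ℂ E]
    {F G : E → ℂ} (hF : Differentiable ℂ F) (hG : Differentiable ℂ G)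
    (hFg : ExpGrowth F) (hGg : ExpGrowth G) (h : ∀ z, F z ^ 2 + G z ^ 2 = 1) :
    ∃ p : E → ℂ, PolynomialOnLines p ∧ ∀ z, F z = Complex.cos (p z) ∧ G z = Complex.sin (p z) := by
  have hmul : ∀ z, (F z + Complex.I * G z) * (F z - Complex.I * G z) = 1 := fun z => by
    linear_combination h z - G z ^ 2 * Complex.I_sq
  have h0 : ∀ z, F z + Complex.I * G z ≠ 0 := fun z => left_ne_zero_of_mul_eq_one (hmul z)
  obtain ⟨p, hp, hexp⟩ := exists_polynomialOnLines_exp_eq (hF.add (hG.const_mul Complex.I)) h0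
    (hFg.add (hGg.const_mul Complex.I))
  refine ⟨p, hp, fun z => ?_⟩
  have h1 : Complex.exp (Complex.I * p z) = F z + Complex.I * G z := hexp z
  have h2 : Complex.exp (-Complex.I * p z) = F z - Complex.I * G z := by
    rw [neg_mul, Complex.exp_neg, h1]
    exact inv_eq_of_mul_eq_one_right (hmul z)
  rw [cos_eq_exp, sin_eq_exp, h1, h2]
  exact ⟨by ring, by linear_combination G z * Complex.I_sq⟩

theorem Transcendental2.not_const_of_eq_cos {f p : ℂ × ℂ → ℂ} {a : ℂ} (hf : Transcendental2 f)
    (h : ∀ z, f z = Complex.cos (p z) / a) : ¬ ∃ κ, ∀ z, p z = κ := by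
  rintro ⟨κ, hκ⟩
  exact hf ⟨MvPolynomial.C (Complex.cos κ / a), fun z => by simp [h, hκ]⟩

end EntireSolutions

open Complex in
theorem stmt_1 (a₁ a₂ a₃ : ℂ) (ha₁ : a₁ ≠ 0) (ha₂ : a₂ ≠ 0) (ha₃ : a₃ ≠ 0)
    (c : ℂ × ℂ) (hc : c ≠ 0) (f₁ f₂ : ℂ × ℂ → ℂ)
    (hf₁e : Entire2 f₁) (hf₁t : Transcendental2 f₁) (hf₁o : FiniteOrder2 f₁)
    (hf₂e : Entire2 f₂) (hf₂t : Transcendental2 f₂) (hf₂o : FiniteOrder2 f₂)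
    (heq1 : ∀ z : ℂ × ℂ, a₁ ^ 2 * f₁ z ^ 2 + (a₂ * f₂ (z + c) + a₃ * f₂ z) ^ 2 = 1)
    (heq2 : ∀ z : ℂ × ℂ, a₁ ^ 2 * f₂ z ^ 2 + (a₂ * f₁ (z + c) + a₃ * f₁ z) ^ 2 = 1) :
    ∃ (α₁ α₂ A k : ℂ) (φ : Polynomial ℂ),
      let g : ℂ × ℂ → ℂ := fun z =>
        α₁ * z.1 + α₂ * z.2 + Polynomial.eval (c.2 * z.1 - c.1 * z.2) φ + A
      let Lc : ℂ := α₁ * c.1 + α₂ * c.2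
      -- Case I
      (((∀ z : ℂ × ℂ, f₁ z = Complex.cos (g z) / a₁) ∧
        (∀ z : ℂ × ℂ, f₂ z = Complex.cos (g z + k) / a₁) ∧
        a₂ ^ 2 = a₁ ^ 2 + a₃ ^ 2 ∧
        Complex.exp (2 * Complex.I * k) = 1 ∧
        Complex.exp (2 * Complex.I * Lc) =
          -(a₁ - Complex.I * a₃ * Complex.exp (-(Complex.I * k))) /
            (a₁ + Complex.I * a₃ * Complex.exp (Complex.I * k))) ∨
      -- Case II
      ((∀ z : ℂ × ℂ, f₁ z = Complex.cos (-(g z) + k) / a₁) ∧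
        (∀ z : ℂ × ℂ, f₂ z = Complex.cos (g z) / a₁) ∧
        (Complex.exp (Complex.I * k)) ^ 2 = -1 ∧
        ((Complex.exp (Complex.I * Lc) = 1 ∧ a₁ ^ 2 = (a₂ + a₃) ^ 2) ∨
          (Complex.exp (Complex.I * Lc) = -1 ∧ a₁ ^ 2 = (a₂ - a₃) ^ 2))) ∨
      -- Case III
      ((∀ z : ℂ × ℂ, f₁ z = Complex.cos (-(g z) + Lc + k) / a₁) ∧
        (∀ z : ℂ × ℂ, f₂ z = Complex.cos (g z) / a₁) ∧
        (Complex.exp (Complex.I * k)) ^ 2 = -1 ∧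
        ((Complex.exp (Complex.I * Lc) = 1 ∧ a₁ ^ 2 = (a₂ + a₃) ^ 2) ∨
          (Complex.exp (Complex.I * Lc) = -1 ∧ a₁ ^ 2 = (a₂ - a₃) ^ 2)))) := by
  have hshift : ∀ {f : ℂ × ℂ → ℂ}, Entire2 f →
      Differentiable ℂ (fun z => a₂ * f (z + c) + a₃ * f z) := fun {f} hf =>
    ((hf.comp (differentiable_id.add_const c)).const_mul a₂).add (hf.const_mul a₃)
  have hgrow : ∀ {f : ℂ × ℂ → ℂ}, ExpGrowth f →
      ExpGrowth (fun z => a₂ * f (z + c) + a₃ * f z) := fun hf =>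
    ((hf.comp_add_right c).const_mul a₂).add (hf.const_mul a₃)
  have hg₁ := hf₁o.expGrowth hf₁e.continuous
  have hg₂ := hf₂o.expGrowth hf₂e.continuous
  obtain ⟨p, hp, hp'⟩ := exists_eq_cos_and_eq_sin (hf₁e.const_mul a₁) (hshift hf₂e)
    (hg₁.const_mul a₁) (hgrow hg₂) (fun z => by rw [mul_pow]; exact heq1 z)
  obtain ⟨q, hq, hq'⟩ := exists_eq_cos_and_eq_sin (hf₂e.const_mul a₁) (hshift hf₁e)
    (hg₂.const_mul a₁) (hgrow hg₁) (fun z => by rw [mul_pow]; exact heq2 z)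
  have hf₁ : ∀ z, f₁ z = Complex.cos (p z) / a₁ := fun z => by
    rw [eq_div_iff ha₁, mul_comm]; exact (hp' z).1
  have hf₂ : ∀ z, f₂ z = Complex.cos (q z) / a₁ := fun z => by
    rw [eq_div_iff ha₁, mul_comm]; exact (hq' z).1
  have hpc := hf₁t.not_const_of_eq_cos hf₁
  have hqc := hf₂t.not_const_of_eq_cos hf₂
  have hsin₁ : ∀ z, a₂ * Complex.cos (q (z + c)) + a₃ * Complex.cos (q z) =
      a₁ * Complex.sin (p z) := fun z => by
    rw [← (hp' z).2, hf₂, hf₂]; field_simp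
  have hsin₂ : ∀ z, a₂ * Complex.cos (p (z + c)) + a₃ * Complex.cos (p z) =
      a₁ * Complex.sin (q z) := fun z => by
    rw [← (hq' z).2, hf₁, hf₁]; field_simp
  have hI2 := Complex.I_sq
  obtain ⟨⟨L, hL⟩, ⟨k, hk⟩ | ⟨k, hk⟩⟩ :=
    hp.exponents_of_cos_add_cos_eq_sin ha₁ ha₂ ha₃ hq hpc hqc hsin₁
  · have hL' : ∀ z, p (z + c) = p z + L := fun z => by
      linear_combination hL z - hk (z + c) + hk z
    obtain ⟨α₁, α₂, φ, hα, hφ⟩ := hp.exists_normal_form hc hL'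
    have hE0 := Complex.exp_ne_zero (I * L)
    obtain ⟨h1, -⟩ := hp.coeff_eq_zero hpc
      (A := a₂ * (Complex.exp (I * L) * Complex.exp (I * k)) + a₃ * Complex.exp (I * k) + I * a₁)
      (B := a₂ * (Complex.exp (I * L) * Complex.exp (I * k))⁻¹ + a₃ * (Complex.exp (I * k))⁻¹ -
        I * a₁) fun z => by
        have := hsin₁ z
        rw [hL, hk, add_assoc, add_comm k L, cos_add_eq_exp, cos_add_eq_exp, sin_eq_exp, mul_add,
          Complex.exp_add] at this
        linear_combination 2 * this
    obtain ⟨h3, h4⟩ := hp.coeff_eq_zero hpc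
      (A := a₂ * Complex.exp (I * L) + a₃ + I * a₁ * Complex.exp (I * k))
      (B := a₂ * (Complex.exp (I * L))⁻¹ + a₃ - I * a₁ * (Complex.exp (I * k))⁻¹) fun z => by
        have := hsin₂ z
        rw [hL', hk, cos_add_eq_exp, sin_add_eq_exp, cos_eq_exp] at this
        linear_combination 2 * this
    have hexp2 : ∀ x, Complex.exp (2 * I * x) = Complex.exp (I * x) ^ 2 := fun x => by
      rw [← Complex.exp_nat_mul]; push_cast; ring_nf
    refine ⟨α₁, α₂, 0, k, φ, .inl ⟨?_, ?_, ?_⟩⟩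
    · intro z; rw [hf₁, hφ]; simp only [add_zero]
    · intro z; rw [hf₂, hk, hφ]; simp only [add_zero]
    rw [hα, hexp2, hexp2, Complex.exp_neg]
    set K := Complex.exp (I * k)
    set T := Complex.exp (I * L)
    have hK2 : K ^ 2 = 1 := by
      have : I * a₁ * (1 - K ^ 2) = 0 := by linear_combination h1 - K * h3
      rcases mul_eq_zero.mp this with h | h
      · exact absurd h (mul_ne_zero Complex.I_ne_zero ha₁)
      · linear_combination -h
    have hKinv : K⁻¹ = K := inv_eq_of_mul_eq_one_left (by rw [← sq, hK2])
    rw [hKinv] at h4 ⊢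
    have h5 : a₂ = (I * a₁ * K - a₃) * T := by
      field_simp at h4
      linear_combination h4
    refine ⟨?_, hK2, ?_⟩
    · linear_combination (-a₃ + I * a₁ * K) * h3 + a₂ * h5 - a₁ ^ 2 * K ^ 2 * hI2 + a₁ ^ 2 * hK2
    · have hden : a₁ + I * a₃ * K ≠ 0 := by
        intro h
        have : I * a₁ * K - a₃ = 0 := by
          linear_combination I * K * h - a₃ * K ^ 2 * hI2 + a₃ * hK2
        rw [this, zero_mul] at h5
        exact ha₂ h5
      rw [eq_div_iff hden]
      linear_combination (-I * K) * (h3 - T * h5) + a₁ * (T ^ 2 + 1) * (K ^ 2 * hI2 - hK2)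
  · obtain ⟨α₁, α₂, φ, hα, hφ⟩ := hq.exists_normal_form hc hL
    have hK0 := Complex.exp_ne_zero (I * k)
    have hE0 := Complex.exp_ne_zero (I * L)
    obtain ⟨h1, h2⟩ := hq.coeff_eq_zero hqc
      (A := a₂ * Complex.exp (I * L) + a₃ - I * a₁ * (Complex.exp (I * k))⁻¹)
      (B := a₂ * (Complex.exp (I * L))⁻¹ + a₃ + I * a₁ * Complex.exp (I * k)) fun z => by
        have := hsin₁ z
        rw [hL, hk, cos_add_eq_exp, sin_add_eq_exp, cos_eq_exp] at this
        simp only [mul_neg, neg_mul, neg_neg] at this ⊢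
        linear_combination 2 * this
    obtain ⟨h3, -⟩ := hq.coeff_eq_zero hqc
      (A := a₂ * Complex.exp (I * L) * (Complex.exp (I * k))⁻¹ + a₃ * (Complex.exp (I * k))⁻¹ +
        I * a₁)
      (B := a₂ * (Complex.exp (I * L))⁻¹ * Complex.exp (I * k) + a₃ * Complex.exp (I * k) -
        I * a₁) fun z => by
        have := hsin₂ z
        have e : -(q z + L) + k = -q z + (-L + k) := by ring
        rw [hk, hk, hL, e, cos_add_eq_exp, cos_add_eq_exp, sin_eq_exp, mul_add,
          Complex.exp_add] at this
        simp only [mul_neg, neg_mul, neg_neg, Complex.exp_neg (I * L), mul_inv, inv_inv] at this ⊢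
        linear_combination 2 * this
    refine ⟨α₁, α₂, 0, k, φ, .inr (.inl ⟨?_, ?_, ?_⟩)⟩
    · intro z; rw [hf₁, hk, hφ]; simp only [add_zero]
    · intro z; rw [hf₂, hφ]; simp only [add_zero]
    rw [hα]
    set K := Complex.exp (I * k)
    set T := Complex.exp (I * L)
    have hK2 : K ^ 2 = -1 := by
      have h5 : I * a₁ * (K ^ 2 + 1) = 0 := by
        field_simp at h1 h3
        linear_combination K * h3 - h1
      rcases mul_eq_zero.mp h5 with h | h
      · exact absurd h (mul_ne_zero Complex.I_ne_zero ha₁)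
      · linear_combination h
    have hKinv : K⁻¹ = -K := inv_eq_of_mul_eq_one_right (by linear_combination -hK2)
    rw [hKinv] at h1
    have hT2 : (T - 1) * (T + 1) = 0 := by
      have : a₂ * ((T - 1) * (T + 1)) = 0 := by
        field_simp at h2
        linear_combination T * h1 - h2
      exact (mul_eq_zero.mp this).resolve_left ha₂
    refine ⟨hK2, ?_⟩
    rcases mul_eq_zero.mp hT2 with h | h
    · have hT : T = 1 := by linear_combination h
      refine .inl ⟨hT, ?_⟩
      rw [hT] at h1
      linear_combination -(a₂ + a₃ - I * a₁ * K) * h1 - a₁ ^ 2 * I ^ 2 * hK2 + a₁ ^ 2 * hI2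
    · have hT : T = -1 := by linear_combination h
      refine .inr ⟨hT, ?_⟩
      rw [hT] at h1
      linear_combination -(-a₂ + a₃ - I * a₁ * K) * h1 - a₁ ^ 2 * I ^ 2 * hK2 + a₁ ^ 2 * hI2
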